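/- Orthogonality of the components of the longitudinal efficient influence function: writing D^{*,d}_t = H^d_t · (Q̄^d_{t+1} − Q̄^d_t) for t = 0, …, K+1 (with the t = 0 term equal to Q̄^d_1(l_0) − Q̄^d_0), one has E_p[ D^{*,d}_s · D^{*,d}_t ] = 0 for all s ≠ t, and consequently E_p[(D^{*,d})²] = Σ_{t=0}^{K+1} E_p[(D^{*,d}_t)²]. -/

import Mathlib

/-!
Longitudinal data structure `O = (L(0), A(0), …, A(K), L(K+1))` with full-support pmf `p`.
Histories are encoded by full trajectories together with agreement predicates on time prefixes;
a sum over histories `l̄(t)` is encoded as a sum over full covariate trajectories whose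
coordinates beyond `t` are pinned to an arbitrary base point `l₀` (`tailEq`).
-/

open Finset
open scoped Classical

noncomputable section

variable {K : ℕ} {L : Fin (K + 2) → Type} {A : Fin (K + 1) → Type}

/-- Covariate trajectories. -/
abbrev Traj (K : ℕ) (L : Fin (K + 2) → Type) : Type := ∀ s : Fin (K + 2), L s

/-- Treatment trajectories. -/
abbrev Trt (K : ℕ) (A : Fin (K + 1) → Type) : Type := ∀ s : Fin (K + 1), A s

/-- Observations. -/
abbrev Obs (K : ℕ) (L : Fin (K + 2) → Type) (A : Fin (K + 1) → Type) : Type :=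
  Traj K L × Trt K A

/-- Agreement of covariate trajectories on time indices `< t` (i.e. they share `l̄(t-1)`). -/
def aL (t : ℕ) (l l' : Traj K L) : Prop := ∀ s : Fin (K + 2), (s : ℕ) < t → l s = l' s

/-- Agreement of treatment trajectories on time indices `< t` (i.e. they share `ā(t-1)`). -/
def aA (t : ℕ) (a a' : Trt K A) : Prop := ∀ s : Fin (K + 1), (s : ℕ) < t → a s = a' s

variable [∀ t, Fintype (L t)] [∀ t, Fintype (A t)]

/-- Mass of the event that the covariates agree with `l` on indices `< tL` and the treatments
agree with `a` on indices `< tA`. -/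
def marg (p : Obs K L A → ℝ) (tL tA : ℕ) (l : Traj K L) (a : Trt K A) : ℝ :=
  ∑ o' : Obs K L A, if aL tL l o'.1 ∧ aA tA a o'.2 then p o' else 0

/-- The conditional factor `q_t(l_t ∣ l̄(t-1), ā(t-1))`. -/
def qC (p : Obs K L A → ℝ) (t : ℕ) (l : Traj K L) (a : Trt K A) : ℝ :=
  marg p (t + 1) t l a / marg p t t l a

/-- The treatment mechanism factor `g_t(a_t ∣ l̄(t), ā(t-1))`. -/
def gC (p : Obs K L A → ℝ) (t : ℕ) (l : Traj K L) (a : Trt K A) : ℝ :=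
  marg p (t + 1) (t + 1) l a / marg p (t + 1) t l a

/-- The cumulative treatment probability `g_{0:t-1}(ā(t-1), l̄(t-1))`; in particular
`gCum p 0 = 1` is the convention `g_{0:-1} = 1`. -/
def gCum (p : Obs K L A → ℝ) (t : ℕ) (l : Traj K L) (a : Trt K A) : ℝ :=
  ∏ m ∈ Finset.range t, gC p m l a

/-- The treatment trajectory determined by the regimen `d` along the covariates `l`. -/
def aOf (d : ∀ t : Fin (K + 1), Traj K L → A t) (l : Traj K L) : Trt K A := fun s => d s l

/-- A regimen is adapted: `d_t` depends only on `l̄(t)`. -/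
def Adapted (d : ∀ t : Fin (K + 1), Traj K L → A t) : Prop :=
  ∀ t : Fin (K + 1), ∀ l l' : Traj K L, aL ((t : ℕ) + 1) l l' → d t l = d t l'

/-- The event `ā(t-1) = d(l̄(t-1))`. -/
def follows (d : ∀ t : Fin (K + 1), Traj K L → A t) (t : ℕ) (o : Obs K L A) : Prop :=
  ∀ s : Fin (K + 1), (s : ℕ) < t → o.2 s = d s o.1

/-- The inverse probability weight
`H^d_t(ā(t-1), l̄(t-1)) = 1{ā(t-1) = d(l̄(t-1))} / g_{0:t-1}`; `Hd p d 0 = 1`. -/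
def Hd (p : Obs K L A → ℝ) (d : ∀ t : Fin (K + 1), Traj K L → A t) (t : ℕ)
    (o : Obs K L A) : ℝ :=
  (if follows d t o then (1 : ℝ) else 0) / gCum p t o.1 o.2

/-- The sequential regression `Q̄^d_t(l̄(t-1))`, defined downward from
`Q̄^d_{K+2}(l̄(K+1)) = y(l_{K+1})` by
`Q̄^d_t(l̄(t-1)) = Σ_{l_t} q_t(l_t ∣ l̄(t-1), d(l̄(t-1))) Q̄^d_{t+1}(l̄(t))`. -/
def Qbar (p : Obs K L A → ℝ) (y : L (Fin.last (K + 1)) → ℝ)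
    (d : ∀ t : Fin (K + 1), Traj K L → A t) (t : ℕ) (l : Traj K L) : ℝ :=
  if ht : t < K + 2 then
    ∑ v : L ⟨t, ht⟩,
      qC p t (Function.update l ⟨t, ht⟩ v) (aOf d (Function.update l ⟨t, ht⟩ v)) *
        Qbar p y d (t + 1) (Function.update l ⟨t, ht⟩ v)
  else y (l (Fin.last (K + 1)))
termination_by K + 2 - t
decreasing_by omega

/-- The G-computation mass `P^d_t(l̄(t)) = Π_{m=0}^{t} q_m(l_m ∣ l̄(m-1), d(l̄(m-1)))`. -/
def Pd (p : Obs K L A → ℝ) (d : ∀ t : Fin (K + 1), Traj K L → A t) (t : ℕ)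
    (l : Traj K L) : ℝ :=
  ∏ m ∈ Finset.range (t + 1), qC p m l (aOf d l)

/-- `l` agrees with the base point `l₀` on indices `> t`: summing a function of `l̄(t)` over
trajectories pinned to `l₀` beyond `t` realizes the sum over histories `l̄(t)`. -/
def tailEq (t : ℕ) (l₀ l : Traj K L) : Prop := ∀ s : Fin (K + 2), t < (s : ℕ) → l s = l₀ s

/-- The `t`-th component of the efficient influence function,
`D^{*,d}_t = H^d_t · (Q̄^d_{t+1} - Q̄^d_t)` (with `H^d_0 = 1`, so the `t = 0` component is
`Q̄^d_1(l_0) - Q̄^d_0`). -/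
def Dst (p : Obs K L A → ℝ) (y : L (Fin.last (K + 1)) → ℝ)
    (d : ∀ t : Fin (K + 1), Traj K L → A t) (t : ℕ) (o : Obs K L A) : ℝ :=
  Hd p d t o * (Qbar p y d (t + 1) o.1 - Qbar p y d t o.1)

theorem aL.symm {t : ℕ} {l l' : Traj K L} (h : aL t l l') : aL t l' l :=
  fun s hs => (h s hs).symm

theorem aL.trans {t : ℕ} {l l' l'' : Traj K L} (h : aL t l l') (h' : aL t l' l'') :
    aL t l l'' :=
  fun s hs => (h s hs).trans (h' s hs)

theorem aL.mono {t u : ℕ} {l l' : Traj K L} (h : aL t l l') (hu : u ≤ t) : aL u l l' :=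
  fun s hs => h s (hs.trans_le hu)

theorem aA.symm {t : ℕ} {a a' : Trt K A} (h : aA t a a') : aA t a' a :=
  fun s hs => (h s hs).symm

theorem aA.trans {t : ℕ} {a a' a'' : Trt K A} (h : aA t a a') (h' : aA t a' a'') :
    aA t a a'' :=
  fun s hs => (h s hs).trans (h' s hs)

theorem aA.mono {t u : ℕ} {a a' : Trt K A} (h : aA t a a') (hu : u ≤ t) : aA u a a' :=
  fun s hs => h s (hs.trans_le hu)

theorem aL.update {t : ℕ} (ht : t < K + 2) {l l' : Traj K L} (h : aL t l l') (v : L ⟨t, ht⟩) :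
    aL (t + 1) (Function.update l ⟨t, ht⟩ v) (Function.update l' ⟨t, ht⟩ v) := by
  intro s hs
  by_cases hst : s = ⟨t, ht⟩
  · subst hst
    simp
  · have hne : (s : ℕ) ≠ t := fun h => hst (Fin.ext h)
    simp only [Function.update_of_ne hst]
    exact h s (by omega)

theorem aL_update_iff {t : ℕ} (ht : t < K + 2) {l l' : Traj K L} (v : L ⟨t, ht⟩) :
    aL (t + 1) (Function.update l ⟨t, ht⟩ v) l' ↔ aL t l l' ∧ l' ⟨t, ht⟩ = v := by
  constructor
  · intro h
    refine ⟨fun s hs => ?_, ?_⟩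
    · have hne : s ≠ ⟨t, ht⟩ := fun h => by simp [h] at hs
      simpa [Function.update_of_ne hne] using h s (by omega)
    · simpa using (h ⟨t, ht⟩ (Nat.lt_succ_self t)).symm
  · rintro ⟨h, rfl⟩
    simpa using h.update ht (l' ⟨t, ht⟩)

theorem aL_self_update {t : ℕ} (ht : t < K + 2) (l : Traj K L) (v : L ⟨t, ht⟩) :
    aL t l (Function.update l ⟨t, ht⟩ v) := by
  intro s hs
  have hne : s ≠ ⟨t, ht⟩ := fun h => by simp [h] at hs
  rw [Function.update_of_ne hne]

theorem aA_aOf {d : ∀ t : Fin (K + 1), Traj K L → A t} (hd : Adapted d) {t : ℕ}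
    {l l' : Traj K L} (h : aL t l l') : aA t (aOf d l) (aOf d l') :=
  fun s hs => hd s l l' (h.mono hs)

theorem marg_congr (p : Obs K L A → ℝ) {tL tA : ℕ} {l l' : Traj K L} {a a' : Trt K A}
    (hl : aL tL l l') (ha : aA tA a a') : marg p tL tA l a = marg p tL tA l' a' := by
  unfold marg
  refine Finset.sum_congr rfl fun o _ => if_congr ?_ rfl rfl
  exact ⟨fun h => ⟨hl.symm.trans h.1, ha.symm.trans h.2⟩, fun h => ⟨hl.trans h.1, ha.trans h.2⟩⟩

theorem marg_pos {p : Obs K L A → ℝ} (hp : ∀ o, 0 < p o) (tL tA : ℕ) (o : Obs K L A) :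
    0 < marg p tL tA o.1 o.2 := by
  unfold marg
  refine Finset.sum_pos' (fun o' _ => ?_) ⟨o, Finset.mem_univ o, ?_⟩
  · split_ifs
    exacts [(hp o').le, le_rfl]
  · rw [if_pos ⟨fun _ _ => rfl, fun _ _ => rfl⟩]
    exact hp o

theorem qC_congr (p : Obs K L A → ℝ) {t : ℕ} {l l' : Traj K L} {a a' : Trt K A}
    (hl : aL (t + 1) l l') (ha : aA t a a') : qC p t l a = qC p t l' a' := by
  unfold qC
  rw [marg_congr p hl ha, marg_congr p (hl.mono t.le_succ) ha]

theorem gCum_congr (p : Obs K L A → ℝ) {t : ℕ} {l l' : Traj K L} {a a' : Trt K A}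
    (hl : aL t l l') (ha : aA t a a') : gCum p t l a = gCum p t l' a' := by
  refine Finset.prod_congr rfl fun m hm => ?_
  have hm : m + 1 ≤ t := Finset.mem_range.mp hm
  unfold gC
  rw [marg_congr p (hl.mono hm) (ha.mono hm), marg_congr p (hl.mono hm) (ha.mono (by omega))]

theorem Hd_congr (p : Obs K L A → ℝ) {d : ∀ t : Fin (K + 1), Traj K L → A t} (hd : Adapted d)
    {t : ℕ} {o o' : Obs K L A} (hl : aL t o.1 o'.1) (ha : aA t o.2 o'.2) :
    Hd p d t o = Hd p d t o' := by
  unfold Hd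
  rw [gCum_congr p hl ha]
  congr 1
  refine if_congr (forall₂_congr fun s hs => ?_) rfl rfl
  rw [ha s hs, hd s _ _ (hl.mono hs)]

theorem Qbar_congr (p : Obs K L A → ℝ) (y : L (Fin.last (K + 1)) → ℝ)
    {d : ∀ t : Fin (K + 1), Traj K L → A t} (hd : Adapted d) (t : ℕ) {l l' : Traj K L}
    (hl : aL t l l') : Qbar p y d t l = Qbar p y d t l' := by
  rw [Qbar, Qbar]
  split_ifs with ht
  · refine Finset.sum_congr rfl fun v _ => ?_
    have hu := hl.update ht v
    rw [qC_congr p hu (aA_aOf hd (hu.mono t.le_succ)), Qbar_congr p y hd (t + 1) hu]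
  · rw [hl _ (by simp only [Fin.val_last]; omega)]
termination_by K + 2 - t
decreasing_by omega

/-- On the event that treatment follows `d`, the sequential regression is the conditional
expectation of the next one given the observed history. -/
theorem Qbar_eq_condExp (p : Obs K L A → ℝ) (y : L (Fin.last (K + 1)) → ℝ)
    {d : ∀ t : Fin (K + 1), Traj K L → A t} (hd : Adapted d) {t : ℕ} (ht : t < K + 2)
    {o : Obs K L A} (ho : follows d t o) :
    Qbar p y d t o.1 =
      (∑ o' : Obs K L A, if aL t o.1 o'.1 ∧ aA t o.2 o'.2 then
        p o' * Qbar p y d (t + 1) o'.1 else 0) / marg p t t o.1 o.2 := by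
  rw [Qbar, dif_pos ht]
  have hq (v : L ⟨t, ht⟩) :
      qC p t (Function.update o.1 ⟨t, ht⟩ v) (aOf d (Function.update o.1 ⟨t, ht⟩ v)) =
        marg p (t + 1) t (Function.update o.1 ⟨t, ht⟩ v) o.2 / marg p t t o.1 o.2 := by
    have hA : aA t (aOf d (Function.update o.1 ⟨t, ht⟩ v)) o.2 :=
      (aA_aOf hd (aL_self_update ht o.1 v)).symm.trans fun s hs => (ho s hs).symm
    unfold qC
    rw [marg_congr p (fun _ _ => rfl) hA, marg_congr p (aL_self_update ht o.1 v).symm hA]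
  simp_rw [hq, div_mul_eq_mul_div]
  rw [← Finset.sum_div]
  congr 1
  unfold marg
  simp_rw [Finset.sum_mul]
  rw [Finset.sum_comm]
  refine Finset.sum_congr rfl fun o' _ => ?_
  rw [Finset.sum_eq_single (o'.1 ⟨t, ht⟩)]
  · simp only [aL_update_iff, and_true]
    split_ifs with h
    · rw [Qbar_congr p y hd (t + 1) ((aL_update_iff ht _).mpr ⟨h.1, rfl⟩)]
    · simp
  · intro v _ hv
    rw [if_neg, zero_mul]
    exact fun h => hv ((aL_update_iff ht v).mp h.1).2.symm
  · simp

/-- Each component of the efficient influence function has conditional mean zero given the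
history it is a score for. -/
theorem sum_mul_Dst_eq_zero {p : Obs K L A → ℝ} (hp : ∀ o, 0 < p o)
    (y : L (Fin.last (K + 1)) → ℝ) {d : ∀ t : Fin (K + 1), Traj K L → A t} (hd : Adapted d)
    {t : ℕ} (ht : t < K + 2) (F : Obs K L A → ℝ)
    (hF : ∀ o o' : Obs K L A, aL t o.1 o'.1 → aA t o.2 o'.2 → F o = F o') :
    ∑ o : Obs K L A, p o * (F o * Dst p y d t o) = 0 := by
  set G : Obs K L A → ℝ := fun o => F o * Hd p d t o with hG
  have hGcongr (o o' : Obs K L A) (hl : aL t o.1 o'.1) (ha : aA t o.2 o'.2) : G o = G o' := by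
    simp only [hG, hF o o' hl ha, Hd_congr p hd hl ha]
  have hcond (o : Obs K L A) : p o * (G o * Qbar p y d t o.1) =
      ∑ o' : Obs K L A, if aL t o.1 o'.1 ∧ aA t o.2 o'.2 then
        p o * (p o' * (G o' * Qbar p y d (t + 1) o'.1) / marg p t t o'.1 o'.2) else 0 := by
    by_cases ho : follows d t o
    · rw [Qbar_eq_condExp p y hd ht ho, Finset.sum_div, Finset.mul_sum, Finset.mul_sum]
      refine Finset.sum_congr rfl fun o' _ => ?_
      split_ifs with h
      · rw [hGcongr o o' h.1 h.2, marg_congr p h.1 h.2]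
        ring
      · simp
    · have hGo : G o = 0 := by simp [hG, Hd, ho]
      rw [hGo, zero_mul, mul_zero]
      refine (Finset.sum_eq_zero fun o' _ => ?_).symm
      split_ifs with h
      · rw [← hGcongr o o' h.1 h.2, hGo]
        simp
      · rfl
  have htower : ∑ o : Obs K L A, p o * (G o * Qbar p y d t o.1) =
      ∑ o : Obs K L A, p o * (G o * Qbar p y d (t + 1) o.1) := by
    simp_rw [hcond]
    rw [Finset.sum_comm]
    refine Finset.sum_congr rfl fun o' _ => ?_
    have hm := (marg_pos hp t t o').ne'
    calc _ = marg p t t o'.1 o'.2 *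
          (p o' * (G o' * Qbar p y d (t + 1) o'.1) / marg p t t o'.1 o'.2) := by
            conv_rhs => enter [1]; unfold marg
            rw [Finset.sum_mul]
            refine Finset.sum_congr rfl fun o _ => ?_
            rw [ite_mul, zero_mul]
            exact if_congr ⟨fun h => ⟨h.1.symm, h.2.symm⟩, fun h => ⟨h.1.symm, h.2.symm⟩⟩ rfl rfl
      _ = _ := mul_div_cancel₀ _ hm
  calc _ = ∑ o : Obs K L A, (p o * (G o * Qbar p y d (t + 1) o.1) -
        p o * (G o * Qbar p y d t o.1)) := by
          refine Finset.sum_congr rfl fun o _ => ?_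
          simp only [hG, Dst]
          ring
    _ = 0 := by rw [Finset.sum_sub_distrib, htower, sub_self]

theorem sum_Dst_mul_Dst_of_lt {p : Obs K L A → ℝ} (hp : ∀ o, 0 < p o)
    (y : L (Fin.last (K + 1)) → ℝ) {d : ∀ t : Fin (K + 1), Traj K L → A t} (hd : Adapted d)
    {s t : ℕ} (ht : t ≤ K + 1) (hst : s < t) :
    ∑ o : Obs K L A, p o * (Dst p y d s o * Dst p y d t o) = 0 := by
  refine sum_mul_Dst_eq_zero hp y hd (Nat.lt_succ_of_le ht) _ fun o o' hl ha => ?_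
  unfold Dst
  rw [Hd_congr p hd (hl.mono hst.le) (ha.mono hst.le), Qbar_congr p y hd (s + 1) (hl.mono hst),
    Qbar_congr p y hd s (hl.mono hst.le)]

/-- orthogonality of the components of the longitudinal EIF, and the resulting
decomposition `E_p[(D^{*,d})²] = Σ_{t=0}^{K+1} E_p[(D^{*,d}_t)²]`. -/
theorem eif_components_orthogonal [∀ t, Nonempty (L t)] [∀ t, Nonempty (A t)]
    (p : Obs K L A → ℝ) (hp : ∀ o, 0 < p o) (hp1 : ∑ o : Obs K L A, p o = 1)
    (y : L (Fin.last (K + 1)) → ℝ)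
    (d : ∀ t : Fin (K + 1), Traj K L → A t) (hd : Adapted d) :
    (∀ s t : ℕ, s ≤ K + 1 → t ≤ K + 1 → s ≠ t →
      ∑ o : Obs K L A, p o * (Dst p y d s o * Dst p y d t o) = 0) ∧
    ∑ o : Obs K L A, p o * (∑ t ∈ Finset.range (K + 2), Dst p y d t o) ^ 2
      = ∑ t ∈ Finset.range (K + 2), ∑ o : Obs K L A, p o * Dst p y d t o ^ 2 := by
  have horth (s t : ℕ) (hs : s ≤ K + 1) (ht : t ≤ K + 1) (hst : s ≠ t) :
      ∑ o : Obs K L A, p o * (Dst p y d s o * Dst p y d t o) = 0 := by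
    rcases hst.lt_or_gt with h | h
    · exact sum_Dst_mul_Dst_of_lt hp y hd ht h
    · simp_rw [mul_comm (Dst p y d s _)]
      exact sum_Dst_mul_Dst_of_lt hp y hd hs h
  refine ⟨horth, ?_⟩
  simp_rw [sq, Finset.sum_mul_sum, Finset.mul_sum]
  rw [Finset.sum_comm]
  refine Finset.sum_congr rfl fun s hs => ?_
  rw [Finset.sum_comm, Finset.sum_eq_single_of_mem s hs]
  intro t ht hts
  rw [Finset.mem_range] at hs ht
  exact horth s t (by omega) (by omega) hts.symm

end
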